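/- Let A = (a_{ij}) be a positive definite real symmetric n×n matrix such that the n(n+1)/2 real numbers {a_{ij}}_{1 ≤ i ≤ j ≤ n} are linearly independent over ℚ, and let Λ ⊂ ℝⁿ be a lattice with Gram matrix A. If h is a harmonic homogeneous quadratic polynomial on ℝⁿ with Θ_{h;Λ} identically zero on the upper half plane, then h = 0. Consequently, for a basis h₁, …, h_m of the harmonic homogeneous quadratic polynomials, the functions Θ_{h₁;Λ}, …, Θ_{h_m;Λ} are linearly independent over ℝ. -/

import Mathlib

open scoped BigOperators

noncomputable section

/-- The value ᵗv B v of the quadratic form attached to the matrix `B`. -/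
def QF {n : ℕ} (B : Matrix (Fin n) (Fin n) ℝ) (v : Fin n → ℝ) : ℝ :=
  ∑ i, ∑ j, B i j * v i * v j

/-- The standard Euclidean inner product on `ℝⁿ`. -/
def ip {n : ℕ} (v w : Fin n → ℝ) : ℝ := ∑ i, v i * w i

/-- The squared Euclidean norm on `ℝⁿ`. -/
def nsq {n : ℕ} (v : Fin n → ℝ) : ℝ := ∑ i, v i ^ 2

/-- `q^t = exp(2 π i t τ)`. -/
def eq2 (t : ℝ) (τ : ℂ) : ℂ := Complex.exp (2 * Real.pi * Complex.I * t * τ)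

/-- The lattice vector `Σᵢ cᵢ bᵢ` attached to the integer coefficient vector `c`. -/
def LV {n : ℕ} (b : Fin n → Fin n → ℝ) (c : Fin n → ℤ) : Fin n → ℝ :=
  ∑ i, (c i : ℝ) • b i

/-- The theta series with harmonic coefficient `h(x) = ᵗxBx` of the lattice spanned
by `b`, as a function of `τ ∈ ℍ`. -/
def thetaH {n : ℕ} (b : Fin n → Fin n → ℝ) (B : Matrix (Fin n) (Fin n) ℝ) (τ : ℂ) : ℂ :=
  ∑' c : Fin n → ℤ, ((QF B (LV b c) : ℝ) : ℂ) * eq2 (nsq (LV b c)) τ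

theorem QF_eq_dotProduct {n : ℕ} (B : Matrix (Fin n) (Fin n) ℝ) (v : Fin n → ℝ) :
    QF B v = v ⬝ᵥ B.mulVec v := by
  simp only [QF, dotProduct, Matrix.mulVec, Finset.mul_sum]
  exact Finset.sum_congr rfl fun i _ => Finset.sum_congr rfl fun j _ => by ring

theorem LV_eq_vecMul {n : ℕ} (b : Fin n → Fin n → ℝ) (c : Fin n → ℤ) :
    LV b c = Matrix.vecMul (fun i => (c i : ℝ)) (Matrix.of b) := by
  ext k
  simp [LV, Matrix.vecMul, dotProduct]

theorem QF_LV {n : ℕ} (b : Fin n → Fin n → ℝ) (B : Matrix (Fin n) (Fin n) ℝ) (c : Fin n → ℤ) :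
    QF B (LV b c) =
      QF (Matrix.of b * B * (Matrix.of b).transpose) (fun i => (c i : ℝ)) := by
  rw [QF_eq_dotProduct, QF_eq_dotProduct, LV_eq_vecMul, ← Matrix.dotProduct_mulVec,
    ← Matrix.mulVec_transpose, Matrix.mulVec_mulVec, Matrix.mulVec_mulVec, Matrix.mul_assoc]

theorem nsq_LV {n : ℕ} {A : Matrix (Fin n) (Fin n) ℝ} {b : Fin n → Fin n → ℝ}
    (hGram : ∀ i j, A i j = ip (b i) (b j)) (c : Fin n → ℤ) :
    nsq (LV b c) = QF A (fun i => (c i : ℝ)) := by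
  have hA : A = Matrix.of b * 1 * (Matrix.of b).transpose := by
    ext i j
    simp [hGram, ip, Matrix.mul_apply]
  rw [hA, ← QF_LV, QF_eq_dotProduct]
  simp [nsq, dotProduct, pow_two]

theorem sum_prod_eq_sum_le_of_symm {n : ℕ} (F : Fin n × Fin n → ℝ)
    (hF : ∀ p, F p.swap = F p) :
    ∑ p, F p = ∑ p : {p : Fin n × Fin n // p.1 ≤ p.2},
      (if p.1.1 = p.1.2 then F p.1 else 2 * F p.1) := by
  have hsub := Finset.sum_subtype (F := inferInstance) (Finset.univ.filter fun p : Fin n × Fin n => p.1 ≤ p.2)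
    (p := fun p => p.1 ≤ p.2) (by simp) (fun p => if p.1 = p.2 then F p else 2 * F p)
  rw [← hsub, Finset.sum_filter]
  have hswap : ∑ p : Fin n × Fin n, (if p.2 < p.1 then F p else 0) =
      ∑ p : Fin n × Fin n, (if p.1 < p.2 then F p else 0) := by
    refine Fintype.sum_equiv (Equiv.prodComm _ _) _ _ fun p => ?_
    simp [hF]
  have hsplit : ∑ p, F p = ∑ p : Fin n × Fin n, (if p.1 ≤ p.2 then F p else 0) +
      ∑ p : Fin n × Fin n, (if p.2 < p.1 then F p else 0) := by
    rw [← Finset.sum_add_distrib]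
    refine Finset.sum_congr rfl fun p _ => ?_
    rcases le_or_gt p.1 p.2 with h | h
    · simp [h, h.not_gt]
    · simp [h, h.not_ge]
  rw [hsplit, hswap, ← Finset.sum_add_distrib]
  refine Finset.sum_congr rfl fun p _ => ?_
  rcases lt_trichotomy p.1 p.2 with h | h | h
  · simp [h, h.le, h.ne, two_mul]
  · simp [h]
  · simp [h.not_ge, h.not_gt]

/-- Quadratic forms whose matrix has rationally independent entries separate the symmetric
squares of integer vectors. -/
theorem mul_eq_mul_of_QF_eq {n : ℕ} {A : Matrix (Fin n) (Fin n) ℝ} (hAsym : A.IsSymm)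
    (hli : LinearIndependent ℚ
      (fun p : {p : Fin n × Fin n // p.1 ≤ p.2} => A p.1.1 p.1.2))
    {c d : Fin n → ℤ} (h : QF A (fun i => (c i : ℝ)) = QF A (fun i => (d i : ℝ)))
    (i j : Fin n) : c i * c j = d i * d j := by
  have key : ∀ p : {p : Fin n × Fin n // p.1 ≤ p.2},
      c p.1.1 * c p.1.2 = d p.1.1 * d p.1.2 := by
    let δ : Fin n × Fin n → ℚ := fun p => c p.1 * c p.2 - d p.1 * d p.2
    have hsum : ∑ p : {p : Fin n × Fin n // p.1 ≤ p.2},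
        (if p.1.1 = p.1.2 then δ p.1 else 2 * δ p.1) • A p.1.1 p.1.2 = 0 := by
      have h0 : ∑ p : Fin n × Fin n, A p.1 p.2 * (δ p : ℝ) = 0 := by
        rw [Fintype.sum_prod_type]
        simp only [QF] at h
        rw [← sub_eq_zero, ← Finset.sum_sub_distrib] at h
        rw [← h]
        refine Finset.sum_congr rfl fun i _ => ?_
        rw [← Finset.sum_sub_distrib]
        refine Finset.sum_congr rfl fun j _ => ?_
        simp only [δ]
        push_cast
        ring
      rw [sum_prod_eq_sum_le_of_symm] at h0
      · rw [← h0]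
        refine Finset.sum_congr rfl fun p _ => ?_
        rw [Rat.smul_def]
        split_ifs
        · ring
        · push_cast
          ring
      · rintro ⟨i, j⟩
        simp only [δ, Prod.fst_swap, Prod.snd_swap, hAsym.apply]
        push_cast
        ring
    intro p
    have hp := Fintype.linearIndependent_iff.1 hli _ hsum p
    have hδ : δ p.1 = 0 := by
      split_ifs at hp
      · exact hp
      · linarith
    exact_mod_cast sub_eq_zero.1 hδ
  rcases le_total i j with hij | hij
  · exact key ⟨(i, j), hij⟩
  · rw [mul_comm (c i), mul_comm (d i)]
    exact key ⟨(j, i), hij⟩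

theorem nsq_nonneg {n : ℕ} (v : Fin n → ℝ) : 0 ≤ nsq v :=
  Finset.sum_nonneg fun _ _ => sq_nonneg _

theorem sq_norm_le_nsq {n : ℕ} (v : Fin n → ℝ) : ‖v‖ ^ 2 ≤ nsq v := by
  rw [← Real.le_sqrt (norm_nonneg _) (nsq_nonneg v), pi_norm_le_iff_of_nonneg (Real.sqrt_nonneg _)]
  intro i
  rw [Real.norm_eq_abs]
  exact Real.abs_le_sqrt (Finset.single_le_sum (f := fun i => v i ^ 2)
    (fun _ _ => sq_nonneg _) (Finset.mem_univ i))

theorem abs_QF_le {n : ℕ} (B : Matrix (Fin n) (Fin n) ℝ) (v : Fin n → ℝ) :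
    |QF B v| ≤ (∑ i, ∑ j, |B i j|) * nsq v := by
  rw [QF, Finset.sum_mul]
  refine (Finset.abs_sum_le_sum_abs _ _).trans (Finset.sum_le_sum fun i _ => ?_)
  rw [Finset.sum_mul]
  refine (Finset.abs_sum_le_sum_abs _ _).trans (Finset.sum_le_sum fun j _ => ?_)
  rw [abs_mul, abs_mul, mul_assoc]
  refine mul_le_mul_of_nonneg_left ?_ (abs_nonneg _)
  have hv (k : Fin n) : |v k| ≤ ‖v‖ := norm_le_pi_norm v k
  calc |v i| * |v j| ≤ ‖v‖ * ‖v‖ := by gcongr <;> exact hv _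
    _ = ‖v‖ ^ 2 := (pow_two _).symm
    _ ≤ nsq v := sq_norm_le_nsq v

theorem LV_injective {n : ℕ} {b : Fin n → Fin n → ℝ} (hb : LinearIndependent ℝ b) :
    Function.Injective (LV b) := by
  intro c d h
  have := hb.fintypeLinearCombination_injective (a₁ := fun i => (c i : ℝ))
    (a₂ := fun i => (d i : ℝ)) (by simpa [Fintype.linearCombination_apply, LV] using h)
  ext i
  exact_mod_cast congrFun this i

theorem summable_norm_LV_inv_pow {n : ℕ} {b : Fin n → Fin n → ℝ} (hb : LinearIndependent ℝ b)
    {N : ℕ} (hN : n < N) : Summable fun c : Fin n → ℤ => ‖LV b c‖⁻¹ ^ N := by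
  let β : Module.Basis (Fin n) ℝ (Fin n → ℝ) :=
    basisOfLinearIndependentOfCardEqFinrank' b hb (by simp)
  have hβ : ⇑β = b := coe_basisOfLinearIndependentOfCardEqFinrank' b hb (by simp)
  let γ := β.restrictScalars ℤ
  have hrank : Module.finrank ℤ (Submodule.span ℤ (Set.range β)) = n := by
    rw [Module.finrank_eq_card_basis γ, Fintype.card_fin]
  have hs := ZLattice.summable_norm_pow_inv (L := Submodule.span ℤ (Set.range β)) N
    (by rwa [hrank])
  rw [← γ.equivFun.symm.toEquiv.summable_iff] at hs
  refine hs.congr fun c => ?_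
  have : ((γ.equivFun.symm c : Submodule.span ℤ (Set.range β)) : Fin n → ℝ) = LV b c := by
    simp [γ, Module.Basis.equivFun_symm_apply, LV, hβ, ← Int.cast_smul_eq_zsmul ℝ]
  simp [← this]

theorem summable_nsq_pow_mul_exp {n : ℕ} {b : Fin n → Fin n → ℝ} (hb : LinearIndependent ℝ b)
    (k : ℕ) {s : ℝ} (hs : 0 < s) :
    Summable fun c : Fin n → ℤ => nsq (LV b c) ^ k * Real.exp (-(s * nsq (LV b c))) := by
  let N := k + (n + 1)
  refine Summable.of_norm_bounded_eventually
    ((summable_norm_LV_inv_pow hb (N := 2 * (n + 1)) (by omega)).mul_left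
      ((N.factorial : ℝ) / s ^ N)) ?_
  filter_upwards [(Set.finite_singleton (0 : Fin n → ℤ)).compl_mem_cofinite] with c hc
  have hne : LV b c ≠ 0 := fun h => hc (LV_injective hb (by simpa [LV] using h))
  have hpos : 0 < ‖LV b c‖ := norm_pos_iff.2 hne
  have hle := sq_norm_le_nsq (LV b c)
  set x := nsq (LV b c)
  have hx : 0 < x := lt_of_lt_of_le (by positivity) hle
  have hexp := Real.pow_div_factorial_le_exp (x := s * x) (by positivity) N
  rw [Real.norm_of_nonneg (by positivity), Real.exp_neg]
  calc x ^ k * (Real.exp (s * x))⁻¹ ≤ x ^ k * ((s * x) ^ N / N.factorial)⁻¹ := by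
        gcongr
    _ = N.factorial / s ^ N * x⁻¹ ^ (n + 1) := by
        simp only [N, mul_pow, pow_add, inv_pow]
        field_simp
    _ ≤ N.factorial / s ^ N * ((‖LV b c‖ ^ 2)⁻¹) ^ (n + 1) := by
        gcongr
    _ = N.factorial / s ^ N * ‖LV b c‖⁻¹ ^ (2 * (n + 1)) := by
        rw [pow_mul, inv_pow _ 2]

theorem tendsto_nsq_LV {n : ℕ} {b : Fin n → Fin n → ℝ} (hb : LinearIndependent ℝ b) :
    Filter.Tendsto (fun c => nsq (LV b c)) Filter.cofinite Filter.atTop := by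
  have h := (summable_nsq_pow_mul_exp hb 0 one_pos).tendsto_cofinite_zero
  simp only [pow_zero, one_mul, Real.tendsto_exp_comp_nhds_zero] at h
  exact Filter.tendsto_neg_atBot_iff.1 h

theorem summable_abs_QF_mul_exp {n : ℕ} {b : Fin n → Fin n → ℝ} (hb : LinearIndependent ℝ b)
    (B : Matrix (Fin n) (Fin n) ℝ) {s : ℝ} (hs : 0 < s) :
    Summable fun c : Fin n → ℤ => |QF B (LV b c)| * Real.exp (-(s * nsq (LV b c))) := by
  refine Summable.of_nonneg_of_le (fun c => by positivity) (fun c => ?_)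
    ((summable_nsq_pow_mul_exp hb 1 hs).mul_left (∑ i, ∑ j, |B i j|))
  rw [pow_one, ← mul_assoc]
  exact mul_le_mul_of_nonneg_right (abs_QF_le B _) (Real.exp_nonneg _)

theorem norm_eq2 (t : ℝ) (τ : ℂ) : ‖eq2 t τ‖ = Real.exp (-(2 * Real.pi * τ.im * t)) := by
  rw [eq2, Complex.norm_exp]
  congr 1
  simp
  ring

theorem summable_thetaH {n : ℕ} {b : Fin n → Fin n → ℝ} (hb : LinearIndependent ℝ b)
    (B : Matrix (Fin n) (Fin n) ℝ) {τ : ℂ} (hτ : 0 < τ.im) :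
    Summable fun c : Fin n → ℤ => ((QF B (LV b c) : ℝ) : ℂ) * eq2 (nsq (LV b c)) τ := by
  refine Summable.of_norm ?_
  simp only [norm_mul, norm_eq2, Complex.norm_real, Real.norm_eq_abs]
  exact summable_abs_QF_mul_exp hb B (by positivity)

/-- A generalized Dirichlet series `∑ f(x) exp(-Q(x) t)` vanishing for all `t > 0` has zero
coefficients, if `f` is constant on the fibres of `Q`. -/
theorem eq_zero_of_tsum_mul_exp_eq_zero {ι : Type*} {Q f : ι → ℝ}
    (hQ : Filter.Tendsto Q Filter.cofinite Filter.atTop)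
    (hf : ∀ x y, Q x = Q y → f x = f y)
    (hs : ∀ t : ℝ, 0 < t → Summable fun x => |f x| * Real.exp (-(t * Q x)))
    (h0 : ∀ t : ℝ, 0 < t → ∑' x, f x * Real.exp (-(t * Q x)) = 0) (x : ι) : f x = 0 := by
  by_contra hx
  obtain ⟨x₀, hx₀, hmin⟩ := hQ.exists_within_forall_le (s := {x | f x ≠ 0}) ⟨x, hx⟩
  have hexp (t : ℝ) (y : ι) :
      Real.exp (t * Q x₀) * Real.exp (-(t * Q y)) = Real.exp (-(t * (Q y - Q x₀))) := by
    rw [← Real.exp_add]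
    congr 1
    ring
  classical
  let g : ι → ℝ := fun y => if Q y = Q x₀ then f x₀ else 0
  let F : ℝ → ι → ℝ := fun t y => f y * Real.exp (-(t * (Q y - Q x₀)))
  have hbound : Summable fun y => |f y| * Real.exp (-(1 * (Q y - Q x₀))) := by
    refine ((hs 1 one_pos).mul_left (Real.exp (1 * Q x₀))).congr fun y => ?_
    rw [← hexp]
    ring
  have hlim (y : ι) : Filter.Tendsto (F · y) Filter.atTop (nhds (g y)) := by
    by_cases hy : Q y = Q x₀
    · simp [F, g, hy, hf y x₀ hy]
    by_cases hfy : f y = 0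
    · simp [F, g, hy, hfy]
    have hlt : 0 < Q y - Q x₀ := sub_pos.2 (lt_of_le_of_ne (hmin y hfy) (Ne.symm hy))
    have : Filter.Tendsto (fun t => Real.exp (-(t * (Q y - Q x₀)))) Filter.atTop (nhds 0) :=
      Real.tendsto_exp_neg_atTop_nhds_zero.comp (Filter.tendsto_id.atTop_mul_const hlt)
    simpa [F, g, hy] using this.const_mul (f y)
  have hle : ∀ t : ℝ, 1 ≤ t → ∀ y, ‖F t y‖ ≤ |f y| * Real.exp (-(1 * (Q y - Q x₀))) := by
    intro t ht y
    by_cases hfy : f y = 0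
    · simp [F, hfy]
    have hnn : 0 ≤ Q y - Q x₀ := sub_nonneg.2 (hmin y hfy)
    simp only [F, norm_mul, Real.norm_eq_abs, Real.abs_exp]
    gcongr
  have hF0 : ∀ t : ℝ, 1 ≤ t → ∑' y, F t y = 0 := by
    intro t ht
    have := congrArg (Real.exp (t * Q x₀) * ·) (h0 t (by linarith))
    simp only [mul_zero, ← tsum_mul_left] at this
    rw [← this]
    refine tsum_congr fun y => ?_
    simp only [F]
    rw [← hexp]
    ring
  have htend := tendsto_tsum_of_dominated_convergence hbound hlim
    ((Filter.eventually_ge_atTop 1).mono hle)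
  have hg0 : ∑' y, g y = 0 :=
    tendsto_nhds_unique htend (tendsto_const_nhds.congr'
      ((Filter.eventually_ge_atTop 1).mono fun t ht => (hF0 t ht).symm))
  have hg : Summable g := hbound.of_norm_bounded fun y =>
    le_of_tendsto (hlim y).norm ((Filter.eventually_ge_atTop 1).mono fun t ht => hle t ht y)
  have hsum : HasSum (fun y => f x₀ * g y) 0 := by
    simpa [hg0] using hg.hasSum.mul_left (f x₀)
  have hnn : 0 ≤ fun y => f x₀ * g y := fun y => by
    simp only [g, Pi.zero_apply]
    split_ifs
    · exact mul_self_nonneg _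
    · simp
  have := congrFun ((hasSum_zero_iff_of_nonneg hnn).1 hsum) x₀
  exact hx₀ (by simpa [g] using this)

theorem eq_zero_of_QF_intCast_eq_zero {n : ℕ} {C : Matrix (Fin n) (Fin n) ℝ} (hC : C.IsSymm)
    (h : ∀ c : Fin n → ℤ, QF C (fun i => (c i : ℝ)) = 0) : C = 0 := by
  have hcast (i : Fin n) :
      (fun k => ((Pi.single i 1 : Fin n → ℤ) k : ℝ)) = Pi.single i 1 := by
    ext k
    by_cases hk : k = i <;> simp [hk]
  have hdiag (i : Fin n) : C i i = 0 := by
    have := h (Pi.single i 1)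
    rw [hcast, QF_eq_dotProduct] at this
    simpa using this
  ext i j
  have hij := h (Pi.single i 1 + Pi.single j 1)
  have hadd : (fun k => ((Pi.single i 1 + Pi.single j 1 : Fin n → ℤ) k : ℝ)) =
      Pi.single i 1 + Pi.single j 1 := by
    rw [← hcast i, ← hcast j]
    ext k
    simp
  rw [hadd, QF_eq_dotProduct] at hij
  simp only [Matrix.mulVec_add, add_dotProduct, dotProduct_add, Matrix.mulVec_single_one,
    single_one_dotProduct, Matrix.col_apply, hdiag, hC.apply i j] at hij
  simp only [Matrix.zero_apply]
  linarith

theorem thetaH_ofReal_mul_I {n : ℕ} (b : Fin n → Fin n → ℝ) (B : Matrix (Fin n) (Fin n) ℝ)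
    (t : ℝ) : thetaH b B ((t / (2 * Real.pi) : ℝ) * Complex.I) =
      ((∑' c : Fin n → ℤ, QF B (LV b c) * Real.exp (-(t * nsq (LV b c))) : ℝ) : ℂ) := by
  rw [thetaH, Complex.ofReal_tsum]
  refine tsum_congr fun c => ?_
  rw [eq2, Complex.ofReal_mul, Complex.ofReal_exp]
  congr 2
  have : (Real.pi : ℂ) ≠ 0 := by exact_mod_cast Real.pi_ne_zero
  push_cast
  field_simp
  rw [Complex.I_sq]
  ring

theorem eq_zero_of_thetaH_eq_zero {n : ℕ} {A : Matrix (Fin n) (Fin n) ℝ} (hAsym : A.IsSymm)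
    (hli : LinearIndependent ℚ
      (fun p : {p : Fin n × Fin n // p.1 ≤ p.2} => A p.1.1 p.1.2))
    {b : Fin n → Fin n → ℝ} (hb : LinearIndependent ℝ b)
    (hGram : ∀ i j, A i j = ip (b i) (b j))
    {B : Matrix (Fin n) (Fin n) ℝ} (hB : B.IsSymm)
    (h : ∀ τ : ℂ, 0 < τ.im → thetaH b B τ = 0) : B = 0 := by
  have hcoef : ∀ c, QF B (LV b c) = 0 := by
    refine eq_zero_of_tsum_mul_exp_eq_zero (tendsto_nsq_LV hb) (fun c d hcd => ?_)
      (fun t ht => summable_abs_QF_mul_exp hb B ht) (fun t ht => ?_)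
    · rw [nsq_LV hGram, nsq_LV hGram] at hcd
      have hmul (i j : Fin n) : (c i : ℝ) * c j = d i * d j := by
        exact_mod_cast mul_eq_mul_of_QF_eq hAsym hli hcd i j
      rw [QF_LV, QF_LV]
      simp only [QF, mul_assoc, hmul]
    · have := h ((t / (2 * Real.pi) : ℝ) * Complex.I) (by
        rw [Complex.im_ofReal_mul, Complex.I_im]
        positivity)
      rw [thetaH_ofReal_mul_I] at this
      exact_mod_cast this
  have hunit : IsUnit (Matrix.of b) := Matrix.linearIndependent_rows_iff_isUnit.1 hb
  have hzero : Matrix.of b * B * (Matrix.of b).transpose = 0 := by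
    refine eq_zero_of_QF_intCast_eq_zero ?_ fun c => by rw [← QF_LV, hcoef]
    simp [Matrix.IsSymm, Matrix.transpose_mul, hB.eq, Matrix.mul_assoc]
  rwa [((Matrix.isUnit_transpose (Matrix.of b)).2 hunit).mul_left_eq_zero, hunit.mul_right_eq_zero] at hzero

theorem thetaH_sum_smul {n m : ℕ} {b : Fin n → Fin n → ℝ} (hb : LinearIndependent ℝ b)
    (H : Fin m → Matrix (Fin n) (Fin n) ℝ) (a : Fin m → ℝ) {τ : ℂ} (hτ : 0 < τ.im) :
    thetaH b (∑ j, a j • H j) τ = ∑ j, (a j : ℂ) * thetaH b (H j) τ := by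
  simp only [thetaH, ← tsum_mul_left]
  rw [← Summable.tsum_finsetSum fun j _ => (summable_thetaH hb (H j) hτ).mul_left _]
  refine tsum_congr fun c => ?_
  have : QF (∑ j, a j • H j) (LV b c) = ∑ j, a j * QF (H j) (LV b c) := by
    simp [QF_eq_dotProduct, Matrix.sum_mulVec, dotProduct_sum, Matrix.smul_mulVec]
  rw [this]
  push_cast
  rw [Finset.sum_mul]
  exact Finset.sum_congr rfl fun j _ => by ring

/-- Let `A` be positive definite symmetric with `ℚ`-linearly independent entries
`{a_{ij}}_{i ≤ j}`, and let `Λ ⊂ ℝⁿ` be a lattice with Gram matrix `A`.  If `h` is a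
harmonic homogeneous quadratic polynomial with `Θ_{h;Λ} ≡ 0` then `h = 0`; consequently,
for a basis `h₁, …, h_m` of the harmonic quadratic polynomials the theta series
`Θ_{h₁;Λ}, …, Θ_{h_m;Λ}` are linearly independent over `ℝ`. -/
theorem harmonic_theta_injective_of_rational_independent
    (n : ℕ) (A : Matrix (Fin n) (Fin n) ℝ)
    (hAsym : A.IsSymm) (hApos : A.PosDef)
    (hli : LinearIndependent ℚ
      (fun p : {p : Fin n × Fin n // p.1 ≤ p.2} => A p.1.1 p.1.2))
    (b : Fin n → Fin n → ℝ) (hb : LinearIndependent ℝ b)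
    (hGram : ∀ i j, A i j = ip (b i) (b j)) :
    (∀ B : Matrix (Fin n) (Fin n) ℝ, B.IsSymm → B.trace = 0 →
      (∀ τ : ℂ, 0 < τ.im → thetaH b B τ = 0) → B = 0) ∧
    (∀ (m : ℕ) (H : Fin m → Matrix (Fin n) (Fin n) ℝ),
      (∀ j, (H j).IsSymm) → (∀ j, (H j).trace = 0) →
      LinearIndependent ℝ H →
      (∀ B : Matrix (Fin n) (Fin n) ℝ, B.IsSymm → B.trace = 0 →
        B ∈ Submodule.span ℝ (Set.range H)) →
      ∀ a : Fin m → ℝ,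
        (∀ τ : ℂ, 0 < τ.im → ∑ j, (a j : ℂ) * thetaH b (H j) τ = 0) → a = 0) := by
  refine ⟨fun B hB _ h => eq_zero_of_thetaH_eq_zero hAsym hli hb hGram hB h, ?_⟩
  intro m H hsymm _ hH _ a ha
  have hsum : ∑ j, a j • H j = 0 := by
    refine eq_zero_of_thetaH_eq_zero hAsym hli hb hGram ?_ fun τ hτ => ?_
    · simp [Matrix.IsSymm, Matrix.transpose_sum, (hsymm _).eq]
    · rw [thetaH_sum_smul hb H a hτ, ha τ hτ]
  exact funext (Fintype.linearIndependent_iff.1 hH a hsum)
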